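/- For every ε > 0 there exists a constant c = c(ε) > 0 such that the following holds: for every finite graph G with v = v(G) vertices, with probability at least 1 − ε the random graph G^{cv} — whose vertex set is V(G) and whose edge set is a uniformly random subset of E(G) of size min(⌈c·v⌉, e(G)) — satisfies both (a) |q*(G^{cv}) − q*(G)| < ε, and (b) for every partition 𝒜 of V(G) there exists a partition 𝒜′ of V(G), each of whose parts is a union of parts of 𝒜, such that δ_{𝒜′}(G) ≤ δ_𝒜(G^{cv}) + ε. -/

import Mathlib

open Finset
open scoped Classical

/-- The number of edges of a finite graph. -/
noncomputable def edgeCount {V : Type} [Fintype V] [DecidableEq V] (G : SimpleGraph V) : ℕ :=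
  G.edgeFinset.card

/-- vol(A): the sum over vertices of A of their degree in G. -/
noncomputable def degSum {V : Type} [Fintype V] [DecidableEq V] (G : SimpleGraph V)
    (A : Finset V) : ℕ :=
  ∑ v ∈ A, G.degree v

/-- e(A): the number of edges of G with both endpoints in A. -/
noncomputable def intEdges {V : Type} [Fintype V] [DecidableEq V] (G : SimpleGraph V)
    (A : Finset V) : ℕ :=
  (G.edgeFinset.filter (fun e => ∀ v ∈ e, v ∈ A)).card

/-- The modularity score q_𝒜(G) of a vertex partition 𝒜 of G; it is 0 if G has no edges. -/
noncomputable def modScore {V : Type} [Fintype V] [DecidableEq V] (G : SimpleGraph V)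
    (P : Finpartition (univ : Finset V)) : ℝ :=
  if edgeCount G = 0 then 0 else
    (∑ A ∈ P.parts, (intEdges G A : ℝ)) / (edgeCount G : ℝ)
      - (∑ A ∈ P.parts, (degSum G A : ℝ) ^ 2) / (4 * (edgeCount G : ℝ) ^ 2)

/-- The modularity q*(G) of a graph: the maximum of q_𝒜(G) over all vertex partitions 𝒜. -/
noncomputable def modularity {V : Type} [Fintype V] [DecidableEq V] (G : SimpleGraph V) : ℝ :=
  ⨆ P : Finpartition (univ : Finset V), modScore G P

/-- The probability that the random subgraph G_p of G (each edge of G retained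
independently with probability p) satisfies the predicate Q. -/
noncomputable def subgraphProb {V : Type} [Fintype V] [DecidableEq V] (G : SimpleGraph V)
    (p : ℝ) (Q : SimpleGraph V → Prop) : ℝ :=
  ∑ F ∈ G.edgeFinset.powerset,
    if Q (SimpleGraph.fromEdgeSet (F : Set (Sym2 V))) then
      p ^ F.card * (1 - p) ^ (G.edgeFinset.card - F.card)
    else 0

/-- Probability, under a uniformly random subset of the edge set of G of size
min(k, e(G)), that the resulting graph satisfies Q. -/
noncomputable def uniformSubProb {V : Type} [Fintype V] [DecidableEq V] (G : SimpleGraph V)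
    (k : ℕ) (Q : SimpleGraph V → Prop) : ℝ :=
  (∑ F ∈ G.edgeFinset.powersetCard (min k G.edgeFinset.card),
      if Q (SimpleGraph.fromEdgeSet (F : Set (Sym2 V))) then 1 else 0) /
    ((G.edgeFinset.powersetCard (min k G.edgeFinset.card)).card : ℝ)


section Sampling

variable {α : Type} [DecidableEq α]

lemma card_filter_subset_powersetCard_le {E J : Finset α} (hJ : J ⊆ E) (k : ℕ) :
    ((E.powersetCard k).filter (J ⊆ ·)).card ≤
      if J.card ≤ k then (E.card - J.card).choose (k - J.card) else 0 := by
  split_ifs with h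
  · rw [← card_sdiff_of_subset hJ, ← card_powersetCard]
    refine card_le_card_of_injOn (· \ J) ?_ ?_
    · intro F hF
      simp only [coe_filter, mem_powersetCard, Set.mem_ofPred_eq] at hF
      simp only [mem_coe, mem_powersetCard]
      exact ⟨sdiff_subset_sdiff hF.1.1 le_rfl, by rw [card_sdiff_of_subset hF.2, hF.1.2]⟩
    · intro F hF F' hF' hFF'
      simp only [coe_filter, mem_powersetCard, Set.mem_ofPred_eq] at hF hF' hFF'
      rw [← sdiff_union_of_subset hF.2, hFF', sdiff_union_of_subset hF'.2]
  · rw [Nat.le_zero, card_eq_zero, filter_eq_empty_iff]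
    intro F hF hJF
    exact h ((card_le_card hJF).trans_eq (mem_powersetCard.1 hF).2)

lemma choose_mul_pow_le {a m : ℕ} (ham : a ≤ m) (j : ℕ) :
    a.choose j * m ^ j ≤ m.choose j * a ^ j := by
  have key : a.descFactorial j * m ^ j ≤ m.descFactorial j * a ^ j := by
    induction j with
    | zero => simp
    | succ j ih =>
      rw [Nat.descFactorial_succ, Nat.descFactorial_succ, pow_succ, pow_succ]
      have h : (a - j) * m ≤ (m - j) * a := by
        rw [Nat.sub_mul, Nat.sub_mul, mul_comm m a]
        exact Nat.sub_le_sub_left (Nat.mul_le_mul_left j ham) _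
      calc (a - j) * a.descFactorial j * (m ^ j * m)
          = ((a - j) * m) * (a.descFactorial j * m ^ j) := by ring
        _ ≤ ((m - j) * a) * (m.descFactorial j * a ^ j) := Nat.mul_le_mul h ih
        _ = _ := by ring
  rw [Nat.descFactorial_eq_factorial_mul_choose, Nat.descFactorial_eq_factorial_mul_choose,
    mul_assoc, mul_assoc] at key
  exact Nat.le_of_mul_le_mul_left key (Nat.factorial_pos j)

/-- The exponential moment of a hypergeometric variable is at most that of the binomial variable
with the same mean. -/
lemma sum_one_add_pow_card_inter_le {E S : Finset α} (hS : S ⊆ E) (hE : 0 < E.card) (k : ℕ)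
    {s : ℝ} (hs : 0 ≤ s) :
    ∑ F ∈ E.powersetCard k, (1 + s) ^ (F ∩ S).card ≤
      E.card.choose k * (1 + s * (S.card / E.card)) ^ k := by
  set m := E.card
  have hm : (0 : ℝ) < m := by exact_mod_cast hE
  set z : ℝ := s * (S.card / m) with hz
  have hz0 : 0 ≤ z := by positivity
  have expand : ∀ F : Finset α, (1 + s) ^ (F ∩ S).card =
      ∑ J ∈ S.powerset, if J ⊆ F then s ^ J.card else 0 := by
    intro F
    rw [← sum_filter, ← prod_const, prod_one_add]
    refine sum_congr ?_ fun J _ => prod_const _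
    ext J
    simp only [mem_powerset, mem_filter, subset_inter_iff, and_comm]
  have term : ∀ j ∈ range (S.card + 1),
      S.card.choose j • ((if j ≤ k then ((m - j).choose (k - j) : ℝ) else 0) * s ^ j) ≤
        m.choose k * (k.choose j * z ^ j) := by
    intro j _
    split_ifs with hjk
    · have h1 : ((m.choose k * k.choose j : ℕ) : ℝ) =
          ((m.choose j * (m - j).choose (k - j) : ℕ) : ℝ) := by rw [Nat.choose_mul hjk]
      have h2 : ((S.card.choose j * m ^ j : ℕ) : ℝ) ≤ ((m.choose j * S.card ^ j : ℕ) : ℝ) :=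
        Nat.cast_le.2 (choose_mul_pow_le (card_le_card hS) j)
      push_cast at h1 h2
      have h3 : (S.card.choose j : ℝ) ≤ m.choose j * (S.card / m) ^ j := by
        rw [div_pow, ← mul_div_assoc, le_div_iff₀ (by positivity)]
        exact h2
      rw [nsmul_eq_mul, ← mul_assoc (m.choose k : ℝ), h1, hz, mul_pow]
      calc (S.card.choose j : ℝ) * ((m - j).choose (k - j) * s ^ j)
          ≤ (m.choose j * (S.card / m) ^ j) * ((m - j).choose (k - j) * s ^ j) := by gcongr
        _ = _ := by ring
    · simp only [zero_mul, smul_zero]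
      positivity
  calc ∑ F ∈ E.powersetCard k, (1 + s) ^ (F ∩ S).card
      = ∑ J ∈ S.powerset, (((E.powersetCard k).filter (J ⊆ ·)).card : ℝ) * s ^ J.card := by
        simp_rw [expand]
        rw [sum_comm]
        refine sum_congr rfl fun J _ => ?_
        rw [← sum_filter, sum_const, nsmul_eq_mul]
    _ ≤ ∑ J ∈ S.powerset,
          (if J.card ≤ k then ((m - J.card).choose (k - J.card) : ℝ) else 0) * s ^ J.card := by
        refine sum_le_sum fun J hJ => ?_
        gcongr
        have := card_filter_subset_powersetCard_le ((mem_powerset.1 hJ).trans hS) k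
        exact_mod_cast this
    _ = ∑ j ∈ range (S.card + 1),
          S.card.choose j • ((if j ≤ k then ((m - j).choose (k - j) : ℝ) else 0) * s ^ j) :=
        sum_powerset_apply_card
          (fun j => (if j ≤ k then ((m - j).choose (k - j) : ℝ) else 0) * s ^ j)
    _ ≤ ∑ j ∈ range (S.card + 1), m.choose k * (k.choose j * z ^ j) := sum_le_sum term
    _ ≤ ∑ j ∈ range (S.card + 1 + k), m.choose k * (k.choose j * z ^ j) := by
        refine sum_le_sum_of_subset_of_nonneg (by intro x; simp; omega) fun j _ _ => ?_
        positivity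
    _ = m.choose k * ∑ j ∈ range (k + 1), k.choose j * z ^ j := by
        rw [mul_sum]
        symm
        refine sum_subset (by intro x; simp; omega) fun j _ hj => ?_
        simp [Nat.choose_eq_zero_of_lt (show k < j by simpa using hj)]
    _ = m.choose k * (1 + z) ^ k := by
        rw [add_comm 1 z, add_pow]
        congr 1
        refine sum_congr rfl fun j _ => ?_
        rw [one_pow]; ring

lemma card_filter_le_card_inter_le {E S : Finset α} (hS : S ⊆ E) (hE : 0 < E.card) (k : ℕ)
    {η : ℝ} (hη : 0 < η) (hη1 : η ≤ 1) :
    (((E.powersetCard k).filter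
      (fun F => k * ((S.card : ℝ) / E.card + η) ≤ ((F ∩ S).card : ℝ))).card : ℝ) ≤
      E.card.choose k * Real.exp (-(k * η ^ 2 / 4)) := by
  set p : ℝ := (S.card : ℝ) / E.card with hp
  have hp0 : 0 ≤ p := by positivity
  have hp1 : p ≤ 1 := div_le_one_of_le₀ (by exact_mod_cast card_le_card hS) (by positivity)
  set l : ℝ := η / 2 with hl
  set s : ℝ := Real.exp l - 1 with hs
  have hs0 : 0 ≤ s := by
    have := Real.add_one_le_exp l
    rw [hs]; linarith
  have hs1 : s ≤ l + l ^ 2 := by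
    have := (abs_le.1 (Real.abs_exp_sub_one_sub_id_le
      (show |l| ≤ 1 by rw [abs_of_nonneg (by positivity)]; linarith))).2
    linarith
  set T := (E.powersetCard k).filter (fun F => k * (p + η) ≤ ((F ∩ S).card : ℝ)) with hT
  have lower : (T.card : ℝ) * Real.exp (l * (k * (p + η))) ≤
      E.card.choose k * Real.exp (k * (s * p)) := by
    calc (T.card : ℝ) * Real.exp (l * (k * (p + η)))
        = ∑ F ∈ T, Real.exp (l * (k * (p + η))) := by rw [sum_const, nsmul_eq_mul]
      _ ≤ ∑ F ∈ T, (1 + s) ^ (F ∩ S).card := by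
          refine sum_le_sum fun F hF => ?_
          rw [show 1 + s = Real.exp l by rw [hs]; ring, ← Real.exp_nat_mul, mul_comm _ l]
          have := (mem_filter.1 hF).2
          gcongr
      _ ≤ ∑ F ∈ E.powersetCard k, (1 + s) ^ (F ∩ S).card :=
          sum_le_sum_of_subset_of_nonneg (filter_subset _ _) fun _ _ _ => by positivity
      _ ≤ E.card.choose k * (1 + s * p) ^ k := sum_one_add_pow_card_inter_le hS hE k hs0
      _ ≤ E.card.choose k * Real.exp (k * (s * p)) := by
          rw [Real.exp_nat_mul]
          gcongr
          linarith [Real.add_one_le_exp (s * p)]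
  have hexp : Real.exp (k * (s * p)) ≤
      Real.exp (-(k * η ^ 2 / 4)) * Real.exp (l * (k * (p + η))) := by
    rw [← Real.exp_add, Real.exp_le_exp]
    have h1 : s * p ≤ (l + l ^ 2) * p := by gcongr
    have h2 : l ^ 2 * p ≤ l ^ 2 := mul_le_of_le_one_right (by positivity) hp1
    have h3 : s * p ≤ -(η ^ 2 / 4) + l * (p + η) := by
      rw [hl] at *; nlinarith
    have := mul_le_mul_of_nonneg_left h3 (Nat.cast_nonneg (α := ℝ) k)
    linarith
  refine le_of_mul_le_mul_right ?_ (Real.exp_pos (l * (k * (p + η))))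
  calc _ ≤ _ := lower
    _ ≤ _ := mul_le_mul_of_nonneg_left hexp (by positivity)
    _ = _ := by ring

lemma card_filter_lt_abs_card_inter_sub_le {E S : Finset α} (hS : S ⊆ E) {k : ℕ} (hk : 0 < k)
    (hE : 0 < E.card) {η : ℝ} (hη : 0 < η) (hη1 : η ≤ 1) :
    (((E.powersetCard k).filter
      (fun F => η < |((F ∩ S).card : ℝ) / k - (S.card : ℝ) / E.card|)).card : ℝ) ≤
      2 * (E.card.choose k * Real.exp (-(k * η ^ 2 / 4))) := by
  have hk' : (0 : ℝ) < k := by exact_mod_cast hk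
  have hE' : (0 : ℝ) < E.card := by exact_mod_cast hE
  have h1 := card_filter_le_card_inter_le hS hE k hη hη1
  have h2 := card_filter_le_card_inter_le (sdiff_subset (s := E) (t := S)) hE k hη hη1
  have hsub : (E.powersetCard k).filter
      (fun F => η < |((F ∩ S).card : ℝ) / k - (S.card : ℝ) / E.card|) ⊆
      (E.powersetCard k).filter
        (fun F => k * ((S.card : ℝ) / E.card + η) ≤ ((F ∩ S).card : ℝ)) ∪
      (E.powersetCard k).filter
        (fun F => k * (((E \ S).card : ℝ) / E.card + η) ≤ ((F ∩ (E \ S)).card : ℝ)) := by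
    intro F hF
    rw [mem_filter] at hF
    obtain ⟨hFE, hF⟩ := hF
    rw [mem_union, mem_filter, mem_filter]
    rcases lt_abs.1 hF with h | h
    · refine Or.inl ⟨hFE, ?_⟩
      have : (S.card : ℝ) / E.card + η ≤ ((F ∩ S).card : ℝ) / k := by linarith
      rwa [le_div_iff₀ hk', mul_comm] at this
    · refine Or.inr ⟨hFE, ?_⟩
      obtain ⟨hFE, hFk⟩ := mem_powersetCard.1 hFE
      have e1 : ((E \ S).card : ℝ) = E.card - S.card := by
        have := card_sdiff_add_card_eq_card hS
        rw [← this]; push_cast; ring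
      have e2 : ((F ∩ (E \ S)).card : ℝ) = k - (F ∩ S).card := by
        have h3 := card_sdiff_add_card_inter F S
        have h4 : F ∩ (E \ S) = F \ S := by
          rw [← inter_sdiff_assoc, inter_eq_left.2 hFE]
        rw [h4, ← hFk, ← h3]; push_cast; ring
      rw [e1, e2, sub_div, div_self hE'.ne']
      have h5 : 1 - (S.card : ℝ) / E.card + η ≤ 1 - ((F ∩ S).card : ℝ) / k := by linarith
      calc _ ≤ k * (1 - ((F ∩ S).card : ℝ) / k) := mul_le_mul_of_nonneg_left h5 hk'.le
        _ = _ := by field_simp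
  have h3 := (card_le_card hsub).trans (card_union_le _ _)
  have h4 : ((_ : ℕ) : ℝ) ≤ ((_ : ℕ) : ℝ) := Nat.cast_le.2 h3
  push_cast at h4
  linarith

/-- Simultaneous concentration over a family of subsets. -/
lemma card_filter_exists_lt_abs_le {ι : Type} [Fintype ι] {E : Finset α} (S : ι → Finset α)
    (hS : ∀ i, S i ⊆ E) {k : ℕ} (hk : 0 < k) (hE : 0 < E.card) {η : ℝ} (hη : 0 < η)
    (hη1 : η ≤ 1) :
    (((E.powersetCard k).filter
      (fun F => ∃ i, η < |((F ∩ S i).card : ℝ) / k - ((S i).card : ℝ) / E.card|)).card : ℝ) ≤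
      Fintype.card ι * (2 * (E.card.choose k * Real.exp (-(k * η ^ 2 / 4)))) := by
  have hsub : (E.powersetCard k).filter
      (fun F => ∃ i, η < |((F ∩ S i).card : ℝ) / k - ((S i).card : ℝ) / E.card|) ⊆
      univ.biUnion fun i => (E.powersetCard k).filter
        (fun F => η < |((F ∩ S i).card : ℝ) / k - ((S i).card : ℝ) / E.card|) := by
    intro F hF
    obtain ⟨hF, i, hi⟩ := mem_filter.1 hF
    exact mem_biUnion.2 ⟨i, mem_univ i, mem_filter.2 ⟨hF, hi⟩⟩
  have h : ((_ : ℕ) : ℝ) ≤ ((_ : ℕ) : ℝ) :=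
    Nat.cast_le.2 ((card_le_card hsub).trans card_biUnion_le)
  refine h.trans ?_
  push_cast
  refine (sum_le_sum fun i _ =>
    card_filter_lt_abs_card_inter_sub_le (hS i) hk hE hη hη1).trans_eq ?_
  rw [sum_const, nsmul_eq_mul, card_univ]

end Sampling

section Coarsening

variable {V : Type} [Fintype V] [DecidableEq V]

/-- Merging two parts of a partition. -/
lemma Finpartition.exists_merge (P : Finpartition (univ : Finset V)) {B C : Finset V}
    (hB : B ∈ P.parts) (hC : C ∈ P.parts) (hBC : B ≠ C) :
    ∃ P' : Finpartition (univ : Finset V), P ≤ P' ∧ P'.parts.card + 1 = P.parts.card ∧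
      ∀ f : Finset V → ℝ,
        ∑ A ∈ P'.parts, f A = ∑ A ∈ P.parts, f A - f B - f C + f (B ∪ C) := by
  set Q := (P.parts.erase B).erase C with hQ
  have hCB : C ∈ P.parts.erase B := mem_erase.2 ⟨hBC.symm, hC⟩
  have hQP : Q ⊆ P.parts := (erase_subset _ _).trans (erase_subset _ _)
  have hdisj : ∀ A ∈ Q, Disjoint A (B ∪ C) := by
    intro A hA
    obtain ⟨hAC, hA⟩ := mem_erase.1 hA
    obtain ⟨hAB, hA⟩ := mem_erase.1 hA
    exact disjoint_union_right.2 ⟨P.disjoint hA hB hAB, P.disjoint hA hC hAC⟩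
  have hne : B ∪ C ≠ ⊥ := by
    obtain ⟨x, hx⟩ := P.nonempty_of_mem_parts hB
    exact Nonempty.ne_empty ⟨x, mem_union_left _ hx⟩
  have hsup : Q.sup id ⊔ (B ∪ C) = univ := by
    rw [eq_univ_iff_forall]
    intro x
    obtain ⟨A, hA, hx⟩ := P.exists_mem (mem_univ x)
    rw [sup_eq_union, mem_union, mem_union]
    by_cases hAB : A = B
    · exact Or.inr (Or.inl (hAB ▸ hx))
    by_cases hAC : A = C
    · exact Or.inr (Or.inr (hAC ▸ hx))
    · exact Or.inl (mem_sup.2 ⟨A, mem_erase.2 ⟨hAC, mem_erase.2 ⟨hAB, hA⟩⟩, hx⟩)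
  have hnot : B ∪ C ∉ Q := fun h => hne (disjoint_self.1 (hdisj _ h))
  refine ⟨(P.ofSubset hQP rfl).extend hne (Finset.disjoint_sup_left.2 hdisj) hsup, ?_, ?_, ?_⟩
  · intro A hA
    by_cases hAB : A = B
    · exact ⟨B ∪ C, mem_insert_self _ _, hAB ▸ subset_union_left⟩
    by_cases hAC : A = C
    · exact ⟨B ∪ C, mem_insert_self _ _, hAC ▸ subset_union_right⟩
    · exact ⟨A, mem_insert_of_mem (mem_erase.2 ⟨hAC, mem_erase.2 ⟨hAB, hA⟩⟩), le_rfl⟩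
  · change (insert (B ∪ C) Q).card + 1 = _
    rw [card_insert_of_notMem hnot, hQ, card_erase_add_one hCB, card_erase_add_one hB]
  · intro f
    change ∑ A ∈ insert (B ∪ C) Q, f A = _
    rw [sum_insert hnot, ← add_sum_erase _ _ hB, ← add_sum_erase _ _ hCB]
    ring

/-- Among at least two nonnegative weights with sum one there are two of small product. -/
lemma exists_mul_le_of_sum_eq_one {ι : Type} [DecidableEq ι] {s : Finset ι} {y : ι → ℝ}
    (hy : ∑ i ∈ s, y i = 1) (hs : 2 ≤ s.card) :
    ∃ i ∈ s, ∃ j ∈ s, i ≠ j ∧ y i * y j ≤ 1 / (s.card * (s.card - 1)) := by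
  by_contra! hcon
  have hs' : (2 : ℝ) ≤ s.card := by exact_mod_cast hs
  have hcard : (s.offDiag.card : ℝ) = s.card * (s.card - 1) := by
    rw [offDiag_card, Nat.cast_sub (Nat.le_mul_self _)]
    push_cast; ring
  have hpos : (0 : ℝ) < s.card * (s.card - 1) := by nlinarith
  have hne : s.offDiag.Nonempty := by
    rw [← card_pos]
    exact_mod_cast hcard ▸ hpos
  have h1 : ∑ x ∈ s.offDiag, (1 / (s.card * (s.card - 1)) : ℝ) <
      ∑ x ∈ s.offDiag, y x.1 * y x.2 := by
    refine sum_lt_sum_of_nonempty hne fun x hx => ?_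
    rw [mem_offDiag] at hx
    exact hcon _ hx.1 _ hx.2.1 hx.2.2
  rw [sum_const, nsmul_eq_mul, hcard, mul_one_div_cancel hpos.ne'] at h1
  have h2 : ∑ x ∈ s.diag, y x.1 * y x.2 + ∑ x ∈ s.offDiag, y x.1 * y x.2 = 1 := by
    rw [← sum_union (disjoint_diag_offDiag s), diag_union_offDiag, sum_product, ← sum_mul_sum, hy,
      one_mul]
  have h3 : 0 ≤ ∑ x ∈ s.diag, y x.1 * y x.2 := by
    refine sum_nonneg fun x hx => ?_
    rw [(mem_diag.1 hx).2]
    exact mul_self_nonneg _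
  linarith

/-- Every partition can be coarsened to few parts without losing much, for a set function that
loses at most the product of the weights when two parts are merged. -/
lemma Finpartition.exists_coarsening {y φ : Finset V → ℝ}
    (hy : ∀ P : Finpartition (univ : Finset V), ∑ A ∈ P.parts, y A = 1)
    (hφ : ∀ B C, Disjoint B C → φ B + φ C - 2 * (y B * y C) ≤ φ (B ∪ C))
    {K : ℕ} (hK : 1 ≤ K) (P : Finpartition (univ : Finset V)) :
    ∃ P' : Finpartition (univ : Finset V), P ≤ P' ∧ P'.parts.card ≤ K ∧
      ∑ A ∈ P.parts, φ A - 2 / K ≤ ∑ A ∈ P'.parts, φ A := by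
  have hK' : (1 : ℝ) ≤ K := by exact_mod_cast hK
  have main : ∀ r : ℕ, K ≤ r → ∀ P : Finpartition (univ : Finset V), P.parts.card = r →
      ∃ P' : Finpartition (univ : Finset V), P ≤ P' ∧ P'.parts.card ≤ K ∧
        ∑ A ∈ P.parts, φ A - 2 / K + 2 / r ≤ ∑ A ∈ P'.parts, φ A := by
    intro r hr
    induction r, hr using Nat.le_induction with
    | base => exact fun P hP => ⟨P, le_rfl, hP.le, by linarith⟩
    | succ r hr ih =>
      intro P hP
      have hr' : (1 : ℝ) ≤ r := hK'.trans (by exact_mod_cast hr)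
      obtain ⟨B, hB, C, hC, hBC, hle⟩ := exists_mul_le_of_sum_eq_one (hy P) (by omega)
      obtain ⟨Q, hPQ, hQ, hsum⟩ := P.exists_merge hB hC hBC
      obtain ⟨P', hQP', hP', hsum'⟩ := ih Q (by omega)
      refine ⟨P', hPQ.trans hQP', hP', le_trans ?_ hsum'⟩
      rw [hsum φ]
      have h1 := hφ B C (P.disjoint hB hC hBC)
      rw [hP] at hle
      have h2 : (2 : ℝ) / r - 2 / (r + 1) = 2 * (1 / ((r + 1) * (r + 1 - 1))) := by
        rw [add_sub_cancel_right]; field_simp; ring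
      push_cast at hle ⊢
      linarith
  by_cases h : K ≤ P.parts.card
  · obtain ⟨P', h1, h2, h3⟩ := main _ h P rfl
    have : (0 : ℝ) ≤ 2 / P.parts.card := by positivity
    exact ⟨P', h1, h2, by linarith⟩
  · have : (0 : ℝ) ≤ 2 / K := by positivity
    exact ⟨P, le_rfl, by omega, by linarith⟩

end Coarsening

section Modularity

variable {V : Type} [Fintype V] [DecidableEq V]

lemma intEdges_univ (G : SimpleGraph V) : intEdges G univ = edgeCount G := by
  simp [intEdges, edgeCount]

lemma intEdges_empty (G : SimpleGraph V) : intEdges G ∅ = 0 := by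
  rw [intEdges, card_eq_zero, filter_eq_empty_iff]
  intro e _
  induction e using Sym2.ind with
  | _ a b => exact fun h => notMem_empty a (h a (Sym2.mem_mk_left a b))

lemma intEdges_add_le (G : SimpleGraph V) {B C : Finset V} (h : Disjoint B C) :
    intEdges G B + intEdges G C ≤ intEdges G (B ∪ C) := by
  rw [intEdges, intEdges, intEdges, ← card_union_of_disjoint]
  · refine card_le_card fun e he => ?_
    simp only [mem_union, mem_filter] at he ⊢
    grind
  · rw [disjoint_filter]
    intro e _ hB hC
    induction e using Sym2.ind with
    | _ a b =>
      exact disjoint_left.1 h (hB a (by simp)) (hC a (by simp))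

lemma degSum_add_intEdges_compl (G : SimpleGraph V) (A : Finset V) :
    degSum G A + intEdges G Aᶜ = edgeCount G + intEdges G A := by
  have h1 : degSum G A = ∑ e ∈ G.edgeFinset, (A.filter (· ∈ e)).card := by
    rw [degSum]
    simp_rw [← G.card_incidenceFinset_eq_degree, G.incidenceFinset_eq_filter, card_filter]
    exact sum_comm
  rw [h1, intEdges, intEdges, edgeCount, card_filter, card_filter, card_eq_sum_ones,
    ← sum_add_distrib, ← sum_add_distrib]
  refine sum_congr rfl fun e he => ?_
  induction e using Sym2.ind with
  | _ a b =>
    have hab : a ≠ b := (SimpleGraph.mem_edgeFinset.1 he : G.Adj a b).ne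
    have h2 : (A.filter (· ∈ s(a, b))).card =
        (if a ∈ A then 1 else 0) + if b ∈ A then 1 else 0 := by
      have h3 : A.filter (· ∈ s(a, b)) = ({a} : Finset V).filter (· ∈ A) ∪
          ({b} : Finset V).filter (· ∈ A) := by
        ext x; simp only [mem_filter, Sym2.mem_iff, mem_union, mem_singleton]; tauto
      rw [h3, card_union_of_disjoint, filter_singleton, filter_singleton]
      · split_ifs <;> simp
      · exact disjoint_filter_filter (by simpa using hab)
    rw [h2]
    by_cases ha : a ∈ A <;> by_cases hb : b ∈ A <;> simp [ha, hb]

lemma degSum_univ (G : SimpleGraph V) : degSum G univ = 2 * edgeCount G := by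
  have := degSum_add_intEdges_compl G univ
  rw [compl_univ, intEdges_empty, intEdges_univ] at this
  omega

lemma degSum_union (G : SimpleGraph V) {B C : Finset V} (h : Disjoint B C) :
    degSum G (B ∪ C) = degSum G B + degSum G C :=
  sum_union h

lemma degSum_le (G : SimpleGraph V) (A : Finset V) : degSum G A ≤ 2 * edgeCount G :=
  degSum_univ G ▸ sum_le_sum_of_subset (subset_univ A)

/-- The contribution of one part to the modularity score. -/
noncomputable def partScore (G : SimpleGraph V) (A : Finset V) : ℝ :=
  (intEdges G A : ℝ) / edgeCount G - ((degSum G A : ℝ) / (2 * edgeCount G)) ^ 2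

lemma modScore_eq_sum (G : SimpleGraph V) (P : Finpartition (univ : Finset V)) :
    modScore G P = ∑ A ∈ P.parts, partScore G A := by
  unfold modScore partScore
  split_ifs with h
  · simp [h]
  · simp_rw [sum_sub_distrib, sum_div, div_pow, mul_pow]
    norm_num

lemma modScore_le_modularity (G : SimpleGraph V) (P : Finpartition (univ : Finset V)) :
    modScore G P ≤ modularity G :=
  le_ciSup (Set.finite_range (modScore G)).bddAbove P

lemma exists_coarsening_modScore {G : SimpleGraph V} (hG : 0 < edgeCount G) {K : ℕ} (hK : 1 ≤ K)
    (P : Finpartition (univ : Finset V)) :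
    ∃ P' : Finpartition (univ : Finset V), P ≤ P' ∧ P'.parts.card ≤ K ∧
      modScore G P - 2 / K ≤ modScore G P' := by
  have hm : (0 : ℝ) < edgeCount G := by exact_mod_cast hG
  simp_rw [modScore_eq_sum]
  refine Finpartition.exists_coarsening (y := fun A => (degSum G A : ℝ) / (2 * edgeCount G))
    (fun P => ?_) (fun B C h => ?_) hK P
  · rw [← sum_div, div_eq_one_iff_eq (by positivity)]
    have h1 : ∑ A ∈ P.parts, degSum G A = degSum G univ := by
      conv_rhs => rw [degSum, ← P.biUnion_parts, sum_biUnion P.disjoint]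
      rfl
    rw [degSum_univ] at h1
    exact_mod_cast h1
  · simp only [partScore, degSum_union G h]
    have h1 : ((intEdges G B : ℝ) + intEdges G C) / edgeCount G ≤
        (intEdges G (B ∪ C) : ℝ) / edgeCount G := by
      gcongr
      exact_mod_cast intEdges_add_le G h
    rw [add_div] at h1
    push_cast
    rw [add_div]
    linarith [sq_nonneg ((degSum G B : ℝ) / (2 * edgeCount G))]

variable {G H : SimpleGraph V} {η : ℝ}

lemma abs_partScore_sub_le (hG : 0 < edgeCount G) (hH : 0 < edgeCount H)
    (h : ∀ A : Finset V,
      |(intEdges H A : ℝ) / edgeCount H - (intEdges G A : ℝ) / edgeCount G| ≤ η)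
    (A : Finset V) : |partScore H A - partScore G A| ≤ 3 * η := by
  have key : ∀ {F : SimpleGraph V}, 0 < edgeCount F →
      (degSum F A : ℝ) / (2 * edgeCount F) = (1 + (intEdges F A : ℝ) / edgeCount F -
        (intEdges F Aᶜ : ℝ) / edgeCount F) / 2 ∧ 0 ≤ (degSum F A : ℝ) / (2 * edgeCount F) ∧
        (degSum F A : ℝ) / (2 * edgeCount F) ≤ 1 := by
    intro F hF
    have hF' : (0 : ℝ) < edgeCount F := by exact_mod_cast hF
    have h1 : (degSum F A : ℝ) + intEdges F Aᶜ = edgeCount F + intEdges F A := by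
      exact_mod_cast degSum_add_intEdges_compl F A
    refine ⟨?_, by positivity, div_le_one_of_le₀ (by exact_mod_cast degSum_le F A)
      (by positivity)⟩
    field_simp
    linarith
  obtain ⟨eG, g0, g1⟩ := key hG
  obtain ⟨eH, h0, h1⟩ := key hH
  unfold partScore
  set yG := (degSum G A : ℝ) / (2 * edgeCount G)
  set yH := (degSum H A : ℝ) / (2 * edgeCount H)
  have hA := abs_le.1 (h A)
  have hAc := abs_le.1 (h Aᶜ)
  have hd : |yH - yG| ≤ η := abs_le.2 ⟨by linarith, by linarith⟩
  have hsq : |yH ^ 2 - yG ^ 2| ≤ 2 * η := by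
    rw [sq_sub_sq, abs_mul]
    refine mul_le_mul (abs_le.2 ⟨by linarith, by linarith⟩) hd (abs_nonneg _) (by norm_num)
  have hsq' := abs_le.1 hsq
  exact abs_le.2 ⟨by linarith, by linarith⟩

lemma abs_modScore_sub_le (hG : 0 < edgeCount G) (hH : 0 < edgeCount H)
    (h : ∀ A : Finset V,
      |(intEdges H A : ℝ) / edgeCount H - (intEdges G A : ℝ) / edgeCount G| ≤ η)
    (P : Finpartition (univ : Finset V)) :
    |modScore H P - modScore G P| ≤ P.parts.card * (3 * η) := by
  rw [modScore_eq_sum, modScore_eq_sum, ← sum_sub_distrib]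
  refine (abs_sum_le_sum_abs _ _).trans ?_
  refine (sum_le_sum fun A _ => abs_partScore_sub_le hG hH h A).trans_eq ?_
  rw [sum_const, nsmul_eq_mul]

lemma exists_coarsening_modScore_transfer (hG : 0 < edgeCount G) (hH : 0 < edgeCount H)
    (hη : 0 ≤ η)
    (h : ∀ A : Finset V,
      |(intEdges H A : ℝ) / edgeCount H - (intEdges G A : ℝ) / edgeCount G| ≤ η)
    {K : ℕ} (hK : 1 ≤ K) (P : Finpartition (univ : Finset V)) :
    ∃ P' : Finpartition (univ : Finset V), P ≤ P' ∧
      modScore H P - (2 / K + K * (3 * η)) ≤ modScore G P' := by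
  obtain ⟨P', hPP', hcard, hle⟩ := exists_coarsening_modScore hH hK P
  refine ⟨P', hPP', ?_⟩
  have h1 := (abs_le.1 (abs_modScore_sub_le hG hH h P')).2
  have h2 : (P'.parts.card : ℝ) * (3 * η) ≤ K * (3 * η) := by gcongr
  linarith

lemma modularity_le_add (hG : 0 < edgeCount G) (hH : 0 < edgeCount H) (hη : 0 ≤ η)
    (h : ∀ A : Finset V,
      |(intEdges H A : ℝ) / edgeCount H - (intEdges G A : ℝ) / edgeCount G| ≤ η)
    {K : ℕ} (hK : 1 ≤ K) : modularity H ≤ modularity G + (2 / K + K * (3 * η)) := by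
  refine ciSup_le fun P => ?_
  obtain ⟨P', -, hP'⟩ := exists_coarsening_modScore_transfer hG hH hη h hK P
  linarith [modScore_le_modularity G P']

end Modularity

lemma le_uniformSubProb {V : Type} [Fintype V] [DecidableEq V] (G : SimpleGraph V) {k : ℕ}
    (hk : k ≤ edgeCount G) {ε : ℝ} (Q : SimpleGraph V → Prop) (B : Finset (Sym2 V) → Prop)
    (hB : (((G.edgeFinset.powersetCard k).filter B).card : ℝ) ≤ ε * (edgeCount G).choose k)
    (hQ : ∀ F ⊆ G.edgeFinset, F.card = k → ¬ B F →
      Q (SimpleGraph.fromEdgeSet (F : Set (Sym2 V)))) :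
    1 - ε ≤ uniformSubProb G k Q := by
  unfold edgeCount at hk hB
  have hpos : (0 : ℝ) < (G.edgeFinset.card.choose k : ℝ) := by
    exact_mod_cast Nat.choose_pos hk
  rw [uniformSubProb, min_eq_left hk, card_powersetCard, le_div_iff₀ hpos, sum_boole]
  have h1 := card_filter_add_card_filter_not (s := G.edgeFinset.powersetCard k) B
  rw [card_powersetCard] at h1
  have h2 : ((G.edgeFinset.powersetCard k).filter (fun F => ¬ B F)).card ≤
      ((G.edgeFinset.powersetCard k).filter
        (fun F : Finset (Sym2 V) => Q (SimpleGraph.fromEdgeSet (F : Set (Sym2 V))))).card := by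
    refine card_le_card fun F hF => ?_
    obtain ⟨hF, hBF⟩ := mem_filter.1 hF
    obtain ⟨hFE, hFk⟩ := mem_powersetCard.1 hF
    exact mem_filter.2 ⟨hF, hQ F hFE hFk hBF⟩
  have h3 : (G.edgeFinset.card.choose k : ℝ) =
      (((G.edgeFinset.powersetCard k).filter B).card : ℝ) +
      (((G.edgeFinset.powersetCard k).filter (fun F => ¬ B F)).card : ℝ) := by
    exact_mod_cast h1.symm
  have h4 : (((G.edgeFinset.powersetCard k).filter (fun F => ¬ B F)).card : ℝ) ≤
      (((G.edgeFinset.powersetCard k).filter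
        (fun F : Finset (Sym2 V) => Q (SimpleGraph.fromEdgeSet (F : Set (Sym2 V))))).card : ℝ) :=
    Nat.cast_le.2 h2
  linarith

lemma edgeFinset_fromEdgeSet_of_subset {V : Type} [Fintype V] [DecidableEq V]
    {G : SimpleGraph V} {F : Finset (Sym2 V)} (hF : F ⊆ G.edgeFinset)
    [Fintype (SimpleGraph.fromEdgeSet (F : Set (Sym2 V))).edgeSet] :
    (SimpleGraph.fromEdgeSet (F : Set (Sym2 V))).edgeFinset = F := by
  ext e
  rw [SimpleGraph.mem_edgeFinset, SimpleGraph.edgeSet_fromEdgeSet]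
  refine ⟨fun h => h.1, fun h => ⟨h, ?_⟩⟩
  exact G.not_isDiag_of_mem_edgeSet (SimpleGraph.mem_edgeFinset.1 (hF h))

lemma two_pow_mul_exp_le {n : ℕ} (hn : 1 ≤ n) {ε x : ℝ} (hε : 0 < ε)
    (hx : (2 + 1 / ε) * n ≤ x) : (2 : ℝ) ^ n * (2 * Real.exp (-x)) ≤ ε := by
  have hn' : (1 : ℝ) ≤ n := by exact_mod_cast hn
  have h1 : Real.exp (-x) ≤ Real.exp (-(n * 2)) * Real.exp (-(1 / ε)) := by
    rw [← Real.exp_add, Real.exp_le_exp]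
    have : 1 / ε * 1 ≤ 1 / ε * n := by gcongr
    linarith
  have h2 : Real.exp (-(1 / ε)) ≤ ε := by
    rw [Real.exp_neg, inv_le_comm₀ (Real.exp_pos _) hε]
    have := Real.add_one_le_exp (1 / ε)
    rw [← one_div]; linarith
  have h3 : (2 : ℝ) ^ n * 2 * Real.exp (-(n * 2)) ≤ 1 := by
    rw [Real.exp_neg, ← div_eq_mul_inv, div_le_one (Real.exp_pos _), Real.exp_nat_mul]
    calc (2 : ℝ) ^ n * 2 ≤ 2 ^ n * 2 ^ n := by
          gcongr; exact le_self_pow₀ (by norm_num) (by omega)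
      _ = 4 ^ n := by rw [← mul_pow]; norm_num
      _ ≤ Real.exp 2 ^ n := by
          gcongr
          have h := Real.add_one_le_exp (1 : ℝ)
          rw [show (2 : ℝ) = 1 + 1 by norm_num, Real.exp_add]
          nlinarith
  calc (2 : ℝ) ^ n * (2 * Real.exp (-x))
      ≤ 2 ^ n * (2 * (Real.exp (-(n * 2)) * Real.exp (-(1 / ε)))) := by gcongr
    _ = (2 ^ n * 2 * Real.exp (-(n * 2))) * Real.exp (-(1 / ε)) := by ring
    _ ≤ 1 * ε := mul_le_mul h3 h2 (Real.exp_pos _).le zero_le_one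
    _ = ε := one_mul ε

/-- Corollary (cv-edge-limited search): for every ε > 0 there is c = c(ε) > 0 such that
for every finite graph G with v = v(G) vertices, with probability at least 1 − ε the
random graph G^{cv} (edge set a uniformly random subset of E(G) of size min(⌈c·v⌉, e(G)))
satisfies both (a) |q*(G^{cv}) − q*(G)| < ε, and (b) for every partition 𝒜 of V(G)
there is a partition 𝒜′ whose parts are unions of parts of 𝒜 with
δ_{𝒜′}(G) ≤ δ_𝒜(G^{cv}) + ε. -/
theorem statement4 :
    ∀ ε : ℝ, 0 < ε →
      ∃ c : ℝ, 0 < c ∧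
        ∀ (V : Type) [Fintype V] [DecidableEq V] (G : SimpleGraph V),
          1 - ε ≤ uniformSubProb G ⌈c * (Fintype.card V : ℝ)⌉₊ (fun H =>
            |modularity H - modularity G| < ε ∧
            ∀ A : Finpartition (univ : Finset V),
              ∃ A' : Finpartition (univ : Finset V), A ≤ A' ∧
                modularity G - modScore G A' ≤ (modularity H - modScore H A) + ε) := by
  intro ε hε
  obtain ⟨K, hK⟩ := exists_nat_ge (8 / ε + 1)
  have hK1 : (1 : ℝ) ≤ K := le_trans (le_add_of_nonneg_left (by positivity)) hK
  have hK1' : 1 ≤ K := by exact_mod_cast hK1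
  set η : ℝ := min 1 (ε / (12 * K)) with hη
  have hη0 : 0 < η := lt_min one_pos (by positivity)
  have hη1 : η ≤ 1 := min_le_left _ _
  have herr : 2 / (K : ℝ) + K * (3 * η) ≤ ε / 2 := by
    have h1 : 2 / (K : ℝ) ≤ ε / 4 := by
      rw [div_le_iff₀ (by linarith)]
      have : ε * (8 / ε) ≤ ε * K := by gcongr; linarith
      rw [mul_div_cancel₀ _ hε.ne'] at this
      linarith
    have h2 : (K : ℝ) * (3 * η) ≤ K * (3 * (ε / (12 * K))) := by
      gcongr; exact min_le_right _ _
    have h3 : (K : ℝ) * (3 * (ε / (12 * K))) = ε / 4 := by field_simp; norm_num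
    linarith
  refine ⟨(2 + 1 / ε) * (4 / η ^ 2), by positivity, fun V _ _ G => ?_⟩
  set k := ⌈(2 + 1 / ε) * (4 / η ^ 2) * (Fintype.card V : ℝ)⌉₊ with hk
  rcases le_or_gt (edgeCount G) k with hmk | hkm
  · have hmin : uniformSubProb G k = uniformSubProb G (edgeCount G) := by
      funext Q
      have : min k G.edgeFinset.card = min (edgeCount G) G.edgeFinset.card := by
        unfold edgeCount at hmk ⊢
        rw [min_eq_right hmk, min_self]
      unfold uniformSubProb
      rw [this]
    rw [hmin]
    refine le_uniformSubProb G le_rfl _ (fun _ => False) ?_ ?_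
    · simp only [filter_false, card_empty, Nat.cast_zero]
      positivity
    · intro F hF hcard _
      have hFG : SimpleGraph.fromEdgeSet (F : Set (Sym2 V)) = G := by
        rw [eq_of_subset_of_card_le hF hcard.ge, SimpleGraph.coe_edgeFinset,
          SimpleGraph.fromEdgeSet_edgeSet]
      rw [hFG]
      exact ⟨by simpa using hε, fun A => ⟨A, le_rfl, by linarith⟩⟩
  have hm : 0 < edgeCount G := by omega
  have hn : 1 ≤ Fintype.card V := by
    by_contra hn
    have : IsEmpty V := Fintype.card_eq_zero_iff.1 (by omega)
    obtain ⟨e, -⟩ := card_pos.1 hm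
    exact e.ind fun a _ => this.elim a
  have hn' : (1 : ℝ) ≤ Fintype.card V := by exact_mod_cast hn
  have hk0 : 0 < k := Nat.ceil_pos.2 (by positivity)
  let S : Finset V → Finset (Sym2 V) := fun A => G.edgeFinset.filter (fun e => ∀ v ∈ e, v ∈ A)
  refine le_uniformSubProb G hkm.le _ (fun F => ∃ A, η < |((F ∩ S A).card : ℝ) / k -
    ((S A).card : ℝ) / G.edgeFinset.card|) ?_ ?_
  · have hbad := card_filter_exists_lt_abs_le S (fun A => filter_subset _ _) hk0 hm hη0 hη1
    refine le_trans (le_of_eq (by congr!)) (hbad.trans ?_)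
    have hx : (2 + 1 / ε) * Fintype.card V ≤ k * η ^ 2 / 4 := by
      calc (2 + 1 / ε) * (Fintype.card V : ℝ)
          = ((2 + 1 / ε) * (4 / η ^ 2) * Fintype.card V) * η ^ 2 / 4 := by field_simp
        _ ≤ k * η ^ 2 / 4 := by gcongr; exact Nat.le_ceil _
    have h := two_pow_mul_exp_le hn hε hx
    rw [Fintype.card_finset]
    push_cast
    calc _ = (2 ^ Fintype.card V * (2 * Real.exp (-(k * η ^ 2 / 4)))) *
          ((edgeCount G).choose k : ℝ) := by unfold edgeCount; ring
      _ ≤ _ := by gcongr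
  · intro F hF hcard hgood
    push Not at hgood
    set H := SimpleGraph.fromEdgeSet (F : Set (Sym2 V)) with hHdef
    have hHF : ∀ [Fintype H.edgeSet], H.edgeFinset = F := edgeFinset_fromEdgeSet_of_subset hF
    have hHk : edgeCount H = k := by rw [edgeCount, @hHF, hcard]
    have hH : 0 < edgeCount H := hHk ▸ hk0
    have hclose : ∀ A : Finset V,
        |(intEdges H A : ℝ) / edgeCount H - (intEdges G A : ℝ) / edgeCount G| ≤ η := by
      intro A
      have hint : intEdges H A = (F ∩ S A).card := by
        rw [intEdges, @hHF, inter_filter, inter_eq_left.2 hF]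
      rw [hint, hHk]
      exact hgood A
    have hclose' : ∀ A : Finset V,
        |(intEdges G A : ℝ) / edgeCount G - (intEdges H A : ℝ) / edgeCount H| ≤ η :=
      fun A => abs_sub_comm (α := ℝ) _ _ ▸ hclose A
    have hHG := modularity_le_add hm hH hη0.le hclose hK1'
    have hGH := modularity_le_add hH hm hη0.le hclose' hK1'
    refine ⟨abs_lt.2 ⟨by linarith, by linarith⟩, fun A => ?_⟩
    obtain ⟨A', hAA', hA'⟩ := exists_coarsening_modScore_transfer hm hH hη0.le hclose hK1' A
    exact ⟨A', hAA', by linarith⟩
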